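/- Let p be a prime and let a be a sequence of positive integers realized by a group endomorphism θ : G → G of a group G that has a unique Sylow p-subgroup (exactly one maximal p-subgroup). Then the p-part sequence n ↦ p^(ν_p(a(n))) is realized by a group endomorphism of a locally nilpotent group. -/

import Mathlib

/-- A `p`-subgroup: every element has order a power of `p`. -/
def IsPSubgroup (p : ℕ) {G : Type*} [Group G] (Q : Subgroup G) : Prop :=
  ∀ x ∈ Q, ∃ j : ℕ, orderOf x = p ^ j

/-- A Sylow `p`-subgroup: a `p`-subgroup maximal among `p`-subgroups. -/
def IsSylowPSubgroup (p : ℕ) {G : Type*} [Group G] (P : Subgroup G) : Prop :=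
  IsPSubgroup p P ∧ ∀ Q : Subgroup G, IsPSubgroup p Q → P ≤ Q → Q = P

open Function in
/-- The subgroup of points of period `n` of an endomorphism. -/
def periodicSubgroup {G : Type*} [Group G] (θ : G →* G) (n : ℕ) : Subgroup G where
  carrier := {x | IsPeriodicPt θ n x}
  one_mem' := iterate_map_one θ n
  mul_mem' {x y} hx hy := by
    change θ^[n] (x * y) = x * y
    rw [iterate_map_mul, hx.eq, hy.eq]
  inv_mem' {x} hx := by
    change θ^[n] x⁻¹ = x⁻¹
    rw [iterate_map_inv, hx.eq]

open Function in
/-- The subgroup of all periodic points of an endomorphism. -/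
def periodicPtsSubgroup {G : Type*} [Group G] (θ : G →* G) : Subgroup G where
  carrier := periodicPts θ
  one_mem' := ⟨1, one_pos, iterate_map_one θ 1⟩
  mul_mem' := by
    rintro x y ⟨m, hm, hx⟩ ⟨n, hn, hy⟩
    exact ⟨m * n, Nat.mul_pos hm hn,
      (periodicSubgroup θ (m * n)).mul_mem (hx.mul_const n) (hy.const_mul m)⟩
  inv_mem' := by
    rintro x ⟨m, hm, hx⟩
    exact ⟨m, hm, (periodicSubgroup θ m).inv_mem hx⟩

/-- If every point is periodic, a finitely generated subgroup is fixed by some iterate. -/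
theorem exists_le_periodicSubgroup {X : Type*} [Group X] {σ : X →* X}
    (hσ : ∀ x, x ∈ Function.periodicPts σ) {H : Subgroup X} (hH : H.FG) :
    ∃ n, 0 < n ∧ H ≤ periodicSubgroup σ n := by
  obtain ⟨S, rfl⟩ := hH
  choose m hm hx using hσ
  refine ⟨∏ s ∈ S, m s, Finset.prod_pos fun s _ => hm s, ?_⟩
  rw [Subgroup.closure_le]
  intro s hs
  exact (hx s).trans_dvd (Finset.dvd_prod_of_mem m hs)

theorem isPSubgroup_iff_isPGroup {p : ℕ} (hp : p.Prime) {G : Type*} [Group G] {Q : Subgroup G} :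
    IsPSubgroup p Q ↔ IsPGroup p Q := by
  have := Fact.mk hp
  simp [IsPSubgroup, IsPGroup.iff_orderOf]

theorem IsSylowPSubgroup.mem_iff {p : ℕ} (hp : p.Prime) {G : Type*} [Group G] {P : Subgroup G}
    (hP : IsSylowPSubgroup p P) (huniq : ∀ Q, IsSylowPSubgroup p Q → Q = P) {x : G} :
    x ∈ P ↔ ∃ j : ℕ, x ^ p ^ j = 1 := by
  have := Fact.mk hp
  constructor
  · intro hx
    obtain ⟨j, hj⟩ := hP.1 x hx
    exact ⟨j, hj ▸ pow_orderOf_eq_one x⟩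
  · rintro ⟨j, hj⟩
    have hx : IsPGroup p (Subgroup.zpowers x) := by
      rintro ⟨_, k, rfl⟩
      refine ⟨j, Subtype.ext ?_⟩
      change (x ^ k) ^ p ^ j = 1
      rw [← zpow_natCast, zpow_comm, zpow_natCast, hj, one_zpow]
    obtain ⟨Q, hQ⟩ := hx.exists_le_sylow
    have hQP : (Q : Subgroup G) = P := huniq Q
      ⟨(isPSubgroup_iff_isPGroup hp).2 Q.isPGroup', fun R hR hle =>
        Q.is_maximal' ((isPSubgroup_iff_isPGroup hp).1 hR) hle⟩
    exact hQP ▸ hQ (Subgroup.mem_zpowers x)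

/-- In a finite group whose elements of `p`-power order form a subgroup, that subgroup has
order the `p`-part of the order of the group. -/
theorem card_eq_pow_padicValNat_of_mem_iff {p : ℕ} (hp : p.Prime) {F : Type*} [Group F] [Finite F]
    {Q : Subgroup F} (hQ : ∀ x, x ∈ Q ↔ ∃ j : ℕ, x ^ p ^ j = 1) :
    Nat.card Q = p ^ padicValNat p (Nat.card F) := by
  have := Fact.mk hp
  obtain ⟨S⟩ : Nonempty (Sylow p F) := inferInstance
  have hQp : IsPGroup p Q := fun x => by
    obtain ⟨j, hj⟩ := (hQ x).1 x.2
    exact ⟨j, Subtype.ext hj⟩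
  have hSQ : (S : Subgroup F) ≤ Q := fun x hx => by
    obtain ⟨j, hj⟩ := S.isPGroup' ⟨x, hx⟩
    exact (hQ x).2 ⟨j, congrArg Subtype.val hj⟩
  rw [S.is_maximal' hQp hSQ, ← Nat.factorization_def _ hp]
  exact S.card_eq_multiplicity

/-- If a sequence of positive integers is realized by an endomorphism of a group
with a unique Sylow `p`-subgroup, then its `p`-part sequence is realized by a group
endomorphism of a locally nilpotent group. -/
theorem stmt_6 (p : ℕ) (hp : p.Prime) (a : ℕ → ℕ) (ha : ∀ n : ℕ, 1 ≤ n → 0 < a n)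
    (G : Type) [Group G] (θ : G →* G)
    (hreal : ∀ n : ℕ, 1 ≤ n → {x : G | (⇑θ)^[n] x = x}.Finite ∧
      {x : G | (⇑θ)^[n] x = x}.ncard = a n)
    (hsylow : ∃! P : Subgroup G, IsSylowPSubgroup p P) :
    ∃ (X : Type) (_ : Group X) (σ : X →* X),
      (∀ H : Subgroup X, H.FG → Group.IsNilpotent H) ∧
      ∀ n : ℕ, 1 ≤ n → {x : X | (⇑σ)^[n] x = x}.Finite ∧
        {x : X | (⇑σ)^[n] x = x}.ncard = p ^ padicValNat p (a n) := by
  have := Fact.mk hp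
  obtain ⟨P, hP, huniq⟩ := hsylow
  have hmem (x : G) : x ∈ P ↔ ∃ j : ℕ, x ^ p ^ j = 1 := hP.mem_iff hp huniq
  let X := P ⊓ periodicPtsSubgroup θ
  have hθX (x : G) (hx : x ∈ X) : θ x ∈ X := by
    obtain ⟨hxP, n, hn, hxn⟩ := hx
    obtain ⟨j, hj⟩ := (hmem x).1 hxP
    refine ⟨(hmem _).2 ⟨j, by rw [← map_pow, hj, map_one]⟩, n, hn, ?_⟩
    exact hxn.apply
  let σ : X →* X := (θ.comp X.subtype).codRestrict X fun x => hθX x x.2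
  have hσ (n : ℕ) (x : X) : ((σ^[n] x : X) : G) = θ^[n] x :=
    Function.Semiconj.iterate_right (f := ((↑) : X → G)) (fun _ => rfl) n x
  have hfix (n : ℕ) (x : X) : σ^[n] x = x ↔ θ^[n] (x : G) = x := by
    rw [← hσ, Subtype.ext_iff]
  have hfin (n : ℕ) (hn : 1 ≤ n) : {x : X | σ^[n] x = x}.Finite := by
    refine ((hreal n hn).1.preimage Subtype.val_injective.injOn).subset fun x hx => ?_
    exact (hfix n x).1 hx
  refine ⟨X, inferInstance, σ, fun H hH => ?_, fun n hn => ⟨hfin n hn, ?_⟩⟩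
  · obtain ⟨n, hn, hle⟩ := exists_le_periodicSubgroup (σ := σ) (fun x => by
      obtain ⟨n, hn, hxn⟩ := x.2.2
      exact ⟨n, hn, (hfix n x).2 hxn⟩) hH
    have : Finite H := ((hfin n hn).subset hle).to_subtype
    have hXp : IsPGroup p X := fun x => by
      obtain ⟨j, hj⟩ := (hmem x).1 x.2.1
      exact ⟨j, Subtype.ext hj⟩
    exact (hXp.to_subgroup H).isNilpotent
  · have : Finite (periodicSubgroup θ n) := (hreal n hn).1.to_subtype
    have hcard : Nat.card (periodicSubgroup θ n) = a n := (hreal n hn).2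
    have hQ := card_eq_pow_padicValNat_of_mem_iff hp (Q := P.subgroupOf (periodicSubgroup θ n))
      fun x => by simp [Subgroup.mem_subgroupOf, hmem, Subtype.ext_iff]
    rw [hcard] at hQ
    rw [← hQ, ← Nat.card_coe_set_eq]
    exact Nat.card_congr
      { toFun x := ⟨⟨x.1.1, (hfix n x.1).1 x.2⟩, x.1.2.1⟩
        invFun y := ⟨⟨y.1.1, y.2, n, hn, y.1.2⟩, (hfix n _).2 y.1.2⟩
        left_inv _ := rfl
        right_inv _ := rfl }
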